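/- (Noncommutative Sibson identity, classical-quantum form.) Let α ∈ (0,∞) with α ≠ 1, and set σ⋆ := (Σ_i P(i)·W_i^α)^{1/α} / Tr[(Σ_i P(i)·W_i^α)^{1/α}]. Then for every positive definite d×d density matrix τ: (1/(α−1))·log Σ_i P(i)·Tr[W_i^α τ^{1−α}] = (α/(α−1))·log Tr[(Σ_i P(i)·W_i^α)^{1/α}] + D_α(σ⋆‖τ). -/

import Mathlib

open Matrix
open scoped ComplexOrder

/-- Real power of a (hermitian) matrix via the continuous functional calculus. -/
noncomputable def mpow {ι : Type*} [Fintype ι] [DecidableEq ι]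
    (A : Matrix ι ι ℂ) (r : ℝ) : Matrix ι ι ℂ :=
  cfc (fun x : ℝ => x ^ r) A

/-- Logarithm of a (hermitian) matrix via the continuous functional calculus. -/
noncomputable def mlog {ι : Type*} [Fintype ι] [DecidableEq ι]
    (A : Matrix ι ι ℂ) : Matrix ι ι ℂ :=
  cfc Real.log A

/-- Real part of the trace. -/
noncomputable def trR {ι : Type*} [Fintype ι] (A : Matrix ι ι ℂ) : ℝ :=
  (Matrix.trace A).re

/-- Positive definite density matrices. -/
def Dens (d : ℕ) : Type :=
  {σ : Matrix (Fin d) (Fin d) ℂ // σ.PosDef ∧ σ.trace = 1}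

/-- Petz Rényi divergence of order `α ≠ 1`. -/
noncomputable def Dpetz {d : ℕ} (α : ℝ) (ρ σ : Matrix (Fin d) (Fin d) ℂ) : ℝ :=
  (1 / (α - 1)) * Real.log (trR (mpow ρ α * mpow σ (1 - α)))

theorem Matrix.PosDef.pos_of_mem_spectrum {ι : Type*} [Fintype ι] [DecidableEq ι]
    {A : Matrix ι ι ℂ} (hA : A.PosDef) {x : ℝ} (hx : x ∈ spectrum ℝ A) : 0 < x := by
  rw [hA.1.spectrum_real_eq_range_eigenvalues] at hx
  obtain ⟨i, rfl⟩ := hx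
  exact hA.eigenvalues_pos i

theorem continuousOn_real_spectrum {ι : Type*} [Fintype ι] [DecidableEq ι]
    (A : Matrix ι ι ℂ) (f : ℝ → ℝ) : ContinuousOn f (spectrum ℝ A) :=
  A.finite_real_spectrum.continuousOn f

theorem mpow_isHermitian {ι : Type*} [Fintype ι] [DecidableEq ι]
    (A : Matrix ι ι ℂ) (r : ℝ) : (mpow A r).IsHermitian :=
  cfc_predicate (fun x : ℝ => x ^ r) A

theorem Matrix.PosDef.mpow_mul_mpow {ι : Type*} [Fintype ι] [DecidableEq ι]
    {A : Matrix ι ι ℂ} (hA : A.PosDef) (r s : ℝ) : mpow A r * mpow A s = mpow A (r + s) := by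
  unfold mpow
  rw [← cfc_mul _ _ A (continuousOn_real_spectrum A _) (continuousOn_real_spectrum A _)]
  exact cfc_congr fun x hx => (Real.rpow_add (hA.pos_of_mem_spectrum hx) r s).symm

theorem Matrix.PosDef.isUnit_mpow {ι : Type*} [Fintype ι] [DecidableEq ι]
    {A : Matrix ι ι ℂ} (hA : A.PosDef) (r : ℝ) : IsUnit (mpow A r) := by
  refine IsUnit.of_mul_eq_one (mpow A (-r)) ?_
  rw [hA.mpow_mul_mpow, add_neg_cancel]
  simp only [mpow, Real.rpow_zero]
  exact cfc_const_one ℝ A hA.1.isSelfAdjoint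

theorem Matrix.PosDef.mpow {ι : Type*} [Fintype ι] [DecidableEq ι]
    {A : Matrix ι ι ℂ} (hA : A.PosDef) (r : ℝ) : (mpow A r).PosDef := by
  have h := (Matrix.IsUnit.posDef_star_left_conjugate_iff (x := (1 : Matrix ι ι ℂ))
    (hA.isUnit_mpow (r / 2))).mpr .one
  rwa [mul_one, star_eq_conjTranspose, (mpow_isHermitian A _).eq, hA.mpow_mul_mpow,
    add_halves] at h

theorem mpow_one {ι : Type*} [Fintype ι] [DecidableEq ι]
    {A : Matrix ι ι ℂ} (hA : A.IsHermitian) : mpow A 1 = A := by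
  simp only [mpow, Real.rpow_one]
  exact cfc_id' ℝ A hA.isSelfAdjoint

theorem Matrix.PosDef.mpow_smul_mpow_inv {ι : Type*} [Fintype ι] [DecidableEq ι]
    {A : Matrix ι ι ℂ} (hA : A.PosDef) {c r : ℝ} (hc : 0 ≤ c) (hr : r ≠ 0) :
    _root_.mpow (c • _root_.mpow A (1 / r)) r = c ^ r • A := by
  have hsa : IsSelfAdjoint A := hA.1.isSelfAdjoint
  unfold _root_.mpow
  rw [← cfc_smul c _ A (continuousOn_real_spectrum A _),
    ← cfc_comp _ _ A hsa ((A.finite_real_spectrum.image _).continuousOn _)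
      (continuousOn_real_spectrum A _)]
  conv_rhs => rw [← cfc_id' ℝ A hsa, ← cfc_smul _ _ A (continuousOn_real_spectrum A _)]
  refine cfc_congr fun x hx => ?_
  have hx0 := hA.pos_of_mem_spectrum hx
  simp only [Function.comp_apply, smul_eq_mul]
  rw [Real.mul_rpow hc (Real.rpow_nonneg hx0.le _), ← Real.rpow_mul hx0.le,
    one_div_mul_cancel hr, Real.rpow_one]

theorem Matrix.PosDef.trR_pos {ι : Type*} [Fintype ι] [Nonempty ι]
    {A : Matrix ι ι ℂ} (hA : A.PosDef) : 0 < trR A :=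
  (Complex.lt_def.mp hA.trace_pos).1

theorem Matrix.PosDef.trR_mul_pos {ι : Type*} [Fintype ι] [DecidableEq ι] [Nonempty ι]
    {A B : Matrix ι ι ℂ} (hA : A.PosDef) (hB : B.PosDef) : 0 < trR (A * B) := by
  have h := ((Matrix.IsUnit.posDef_star_left_conjugate_iff (x := B)
    (hA.isUnit_mpow (1 / 2))).mpr hB).trR_pos
  rwa [star_eq_conjTranspose, (mpow_isHermitian A _).eq, trR, Matrix.trace_mul_cycle,
    hA.mpow_mul_mpow, add_halves, mpow_one hA.1] at h

theorem trR_smul {ι : Type*} [Fintype ι] (c : ℝ) (A : Matrix ι ι ℂ) :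
    trR (c • A) = c * trR A := by
  simp [trR, Matrix.trace_smul]

theorem trR_sum {ι κ : Type*} [Fintype ι] (s : Finset κ) (A : κ → Matrix ι ι ℂ) :
    trR (∑ i ∈ s, A i) = ∑ i ∈ s, trR (A i) := by
  simp [trR, Matrix.trace_sum]

theorem Matrix.PosDef.sum_smul {ι κ : Type*} [Fintype ι] [Fintype κ]
    {A : κ → Matrix ι ι ℂ} (hA : ∀ i, (A i).PosDef) {p : κ → ℝ} (hp : ∀ i, 0 ≤ p i)
    (hp1 : ∑ i, p i = 1) : (∑ i, p i • A i).PosDef := by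
  classical
  obtain ⟨j, -, hj⟩ := Finset.exists_ne_zero_of_sum_ne_zero (hp1.trans_ne one_ne_zero)
  rw [← Finset.add_sum_erase _ _ (Finset.mem_univ j)]
  exact ((hA j).smul ((hp j).lt_of_ne' hj)).add_posSemidef
    (Matrix.posSemidef_sum _ fun i _ => (hA i).posSemidef.smul (hp i))

/-- the noncommutative Sibson identity (classical-quantum form). -/
theorem sibson_identity {d n : ℕ} (hd : 0 < d) (hn : 0 < n)
    (W : Fin n → Matrix (Fin d) (Fin d) ℂ)
    (hW : ∀ i, (W i).PosDef ∧ (W i).trace = 1)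
    (P : Fin n → ℝ) (hP : ∀ i, 0 ≤ P i) (hP1 : ∑ i, P i = 1)
    (α : ℝ) (hα : 0 < α) (hα1 : α ≠ 1)
    (σstar : Matrix (Fin d) (Fin d) ℂ)
    (hσstar : σstar = (trR (mpow (∑ i, P i • mpow (W i) α) (1 / α)))⁻¹ •
      mpow (∑ i, P i • mpow (W i) α) (1 / α)) :
    ∀ τ : Matrix (Fin d) (Fin d) ℂ, τ.PosDef → τ.trace = 1 →
      (1 / (α - 1)) * Real.log (∑ i, P i * trR (mpow (W i) α * mpow τ (1 - α))) =
        (α / (α - 1)) * Real.log (trR (mpow (∑ i, P i • mpow (W i) α) (1 / α))) +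
          Dpetz α σstar τ := by
  intro τ hτ _
  have : Nonempty (Fin d) := ⟨⟨0, hd⟩⟩
  have hS : (∑ i, P i • mpow (W i) α).PosDef :=
    Matrix.PosDef.sum_smul (fun i => (hW i).1.mpow α) hP hP1
  have hsum : ∑ i, P i * trR (mpow (W i) α * mpow τ (1 - α)) =
      trR ((∑ i, P i • mpow (W i) α) * mpow τ (1 - α)) := by
    simp only [Finset.sum_mul, trR_sum, smul_mul_assoc, trR_smul]
  rw [hsum, Dpetz, hσstar]
  generalize (∑ i, P i • mpow (W i) α) = S at hS ⊢
  have ht := (hS.mpow (1 / α)).trR_pos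
  rw [hS.mpow_smul_mpow_inv (inv_nonneg.mpr ht.le) hα.ne', smul_mul_assoc, trR_smul,
    Real.log_mul (Real.rpow_pos_of_pos (inv_pos.mpr ht) α).ne'
      (hS.trR_mul_pos (hτ.mpow (1 - α))).ne',
    Real.log_rpow (inv_pos.mpr ht), Real.log_inv]
  ring
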